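/- Let n > 2 be an integer and let f be the potential f(u,r) = k(r)·u^{q-1} as in the context (extended by f(u,r) = f(|u|,r) for u < 0), and assume either ((H⁺) holds and 2_* < l_u ≤ 2^* and 2_* < l_s ≤ 2^*) or ((H⁻) holds and l_u ≥ 2^* and l_s ≥ 2^*). Then for every ε > 0: (a) there exists a smooth function φ : ℝⁿ → [0,∞) with ‖φ‖_{L^∞} < ε such that there is no C_B-mild solution on ℝⁿ × [0,∞) with initial datum φ (every mild solution with datum φ blows up in finite time); (b) there exists a smooth function φ : ℝⁿ → [0,∞) with ‖φ‖_{L^∞} > 1/ε and a global C_B-mild solution u on ℝⁿ × [0,∞) with initial datum φ such that sup_{x∈ℝⁿ} |u(x,t)|·(1+|x|^ν) → 0 as t → +∞ for every 0 ≤ ν < n-2. -/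

import Mathlib

open Real Filter Set MeasureTheory

noncomputable section

namespace Paper

def mExp (l : ℝ) : ℝ := 2 / (l - 2)

def twoStar (n : ℕ) : ℝ := 2 * (n : ℝ) / ((n : ℝ) - 2)

def twoLow (n : ℕ) : ℝ := 2 * ((n : ℝ) - 1) / ((n : ℝ) - 2)

def Aexp (n : ℕ) (l : ℝ) : ℝ := (n : ℝ) - 2 - 2 * mExp l

def Cexp (n : ℕ) (l : ℝ) : ℝ := mExp l * ((n : ℝ) - 2 - mExp l)

/-- The Fowler transform `g(y₁, s; l)` of the nonlinearity `f`. -/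
def fowlerG (f : ℝ → ℝ → ℝ) (l y s : ℝ) : ℝ :=
  f (y * Real.exp (-(mExp l) * s)) (Real.exp s) * Real.exp ((mExp l + 2) * s)

/-- `G(y₁, s; l) = ∫₀^{y₁} g(a, s; l) da`. -/
def Gprim (f : ℝ → ℝ → ℝ) (l y s : ℝ) : ℝ := ∫ a in (0:ℝ)..y, fowlerG f l a s

/-- `U` (with derivative `U'`) solves `U'' + ((n-1)/r) U' + f(U, r) = 0` on `S`. -/
def SolOn (n : ℕ) (f : ℝ → ℝ → ℝ) (U U' : ℝ → ℝ) (S : Set ℝ) : Prop :=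
  ∀ r ∈ S, HasDerivAt U (U' r) r ∧
    HasDerivAt U' (-(((n : ℝ) - 1) / r * U' r + f (U r) r)) r

/-- `U` is a regular solution with `U(0) = α` (C¹ up to the origin, `U'(0)=0`). -/
def RegularSol (n : ℕ) (f : ℝ → ℝ → ℝ) (U U' : ℝ → ℝ) (α : ℝ) : Prop :=
  SolOn n f U U' (Set.Ioi 0) ∧ ContinuousOn U (Set.Ici 0) ∧
    ContinuousOn U' (Set.Ici 0) ∧ U 0 = α ∧ U' 0 = 0

def SingularAtZero (U : ℝ → ℝ) : Prop :=
  Tendsto U (nhdsWithin 0 (Set.Ioi 0)) atTop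

def FastDecayTo (n : ℕ) (U : ℝ → ℝ) (β : ℝ) : Prop :=
  Tendsto (fun r => r ^ ((n : ℝ) - 2) * U r) atTop (nhds β)

def SlowDecay (n : ℕ) (U : ℝ → ℝ) : Prop :=
  Tendsto (fun r => r ^ ((n : ℝ) - 2) * U r) atTop atTop

/-- Condition (F0). -/
def CondF0 (f : ℝ → ℝ → ℝ) : Prop :=
  (∀ p : ℝ × ℝ, 0 ≤ p.1 → 0 < p.2 → ∃ K ε : ℝ, 0 < ε ∧
      ∀ a b : ℝ × ℝ, 0 ≤ a.1 → 0 < a.2 → 0 ≤ b.1 → 0 < b.2 →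
        dist a p < ε → dist b p < ε → |f a.1 a.2 - f b.1 b.2| ≤ K * dist a b) ∧
    (∀ r : ℝ, 0 < r → f 0 r = 0) ∧
    (∀ u r : ℝ, 0 < u → 0 < r → 0 < f u r) ∧
    (∀ r : ℝ, 0 < r → MonotoneOn (fun u => f u r) (Set.Ici 0)) ∧
    (∀ u : ℝ, 0 < u → ∃ C : ℝ, ∀ r : ℝ, 0 < r → r ≤ 1 → f u r * r ^ 2 ≤ C)

/-- Condition (G0) for an autonomous nonlinearity `h`. -/
def CondG0 (h : ℝ → ℝ) : Prop :=
  (∃ h' : ℝ → ℝ, (∀ y : ℝ, 0 < y → HasDerivAt h (h' y) y) ∧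
      ContinuousOn h' (Set.Ioi 0) ∧ StrictMonoOn h' (Set.Ioi 0)) ∧
    Tendsto (fun y => h y / y) (nhdsWithin 0 (Set.Ioi 0)) (nhds 0) ∧
    Tendsto (fun y => h y / y) atTop atTop

/-- `h` is locally Lipschitz on `(0, ∞)`. -/
def LocLip (h : ℝ → ℝ) : Prop :=
  ∀ y : ℝ, 0 < y → ∃ K ε : ℝ, 0 < ε ∧ ∀ a b : ℝ, |a - y| < ε → |b - y| < ε →
    |h a - h b| ≤ K * |a - b|

/-- Condition (Gu), with the autonomous limit `gneg = g^{-∞}` given explicitly. -/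
def CondGuWith (n : ℕ) (f : ℝ → ℝ → ℝ) (lu : ℝ) (gneg : ℝ → ℝ) : Prop :=
  twoLow n < lu ∧
    (∀ K : Set ℝ, IsCompact K → K ⊆ Set.Ioi 0 →
      TendstoUniformlyOn (fun s y => fowlerG f lu y s) gneg atBot K) ∧
    LocLip gneg ∧ (∃ y : ℝ, 0 < y ∧ gneg y ≠ 0) ∧ CondG0 gneg ∧
    (∃ ϖ : ℝ, 0 < ϖ ∧ ∀ y : ℝ, 0 < y →
      Tendsto (fun s => Real.exp (-ϖ * s) * deriv (fun t => fowlerG f lu y t) s)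
        atBot (nhds 0)) ∧
    (lu = twoStar n → ∃ M : ℝ, 0 < M ∧ ∀ y : ℝ, 0 < y →
      MonotoneOn (fun s => fowlerG f lu y s) (Set.Iio (-M)) ∨
        AntitoneOn (fun s => fowlerG f lu y s) (Set.Iio (-M)))

/-- Condition (Gu). -/
def CondGu (n : ℕ) (f : ℝ → ℝ → ℝ) (lu : ℝ) : Prop :=
  ∃ gneg : ℝ → ℝ, CondGuWith n f lu gneg

/-- Condition (Gs), with the autonomous limit `gplus = g^{+∞}` given explicitly. -/
def CondGsWith (n : ℕ) (f : ℝ → ℝ → ℝ) (ls : ℝ) (gplus : ℝ → ℝ) : Prop :=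
  twoLow n < ls ∧
    (∀ K : Set ℝ, IsCompact K → K ⊆ Set.Ioi 0 →
      TendstoUniformlyOn (fun s y => fowlerG f ls y s) gplus atTop K) ∧
    LocLip gplus ∧ (∃ y : ℝ, 0 < y ∧ gplus y ≠ 0) ∧ CondG0 gplus ∧
    (∃ ϖ : ℝ, 0 < ϖ ∧ ∀ y : ℝ, 0 < y →
      Tendsto (fun s => Real.exp (ϖ * s) * deriv (fun t => fowlerG f ls y t) s)
        atTop (nhds 0)) ∧
    (ls = twoStar n → ∃ M : ℝ, 0 < M ∧ ∀ y : ℝ, 0 < y →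
      MonotoneOn (fun s => fowlerG f ls y s) (Set.Ioi M) ∨
        AntitoneOn (fun s => fowlerG f ls y s) (Set.Ioi M))

/-- Condition (Gs). -/
def CondGs (n : ℕ) (f : ℝ → ℝ → ℝ) (ls : ℝ) : Prop :=
  ∃ gplus : ℝ → ℝ, CondGsWith n f ls gplus

/-- Condition (A⁺): `G(y₁, ·; 2^*)` is non-decreasing, strictly somewhere. -/
def CondAplus (n : ℕ) (f : ℝ → ℝ → ℝ) : Prop :=
  (∀ y : ℝ, 0 < y → Monotone (fun s => Gprim f (twoStar n) y s)) ∧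
    ∃ y : ℝ, 0 < y ∧ ∃ s₁ s₂ : ℝ, s₁ < s₂ ∧
      Gprim f (twoStar n) y s₁ < Gprim f (twoStar n) y s₂

/-- Condition (A⁻): `G(y₁, ·; 2^*)` is non-increasing, strictly somewhere. -/
def CondAminus (n : ℕ) (f : ℝ → ℝ → ℝ) : Prop :=
  (∀ y : ℝ, 0 < y → Antitone (fun s => Gprim f (twoStar n) y s)) ∧
    ∃ y : ℝ, 0 < y ∧ ∃ s₁ s₂ : ℝ, s₁ < s₂ ∧
      Gprim f (twoStar n) y s₂ < Gprim f (twoStar n) y s₁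

/-- The heat semigroup `e^{tΔ}` applied to `φ`. -/
def heatOp (n : ℕ) (t : ℝ) (φ : EuclideanSpace ℝ (Fin n) → ℝ)
    (x : EuclideanSpace ℝ (Fin n)) : ℝ :=
  (4 * Real.pi * t) ^ (-(n : ℝ) / 2) * ∫ y, Real.exp (-‖x - y‖ ^ 2 / (4 * t)) * φ y

/-- A global `C_B`-mild solution of `∂ₜ u = Δu + f(u, |x|)`, `u(·,0) = φ`. -/
def CBMildGlobal (n : ℕ) (f : ℝ → ℝ → ℝ) (φ : EuclideanSpace ℝ (Fin n) → ℝ)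
    (u : ℝ → EuclideanSpace ℝ (Fin n) → ℝ) : Prop :=
  (∀ x, u 0 x = φ x) ∧
    (∀ T : ℝ, 0 < T →
      ContinuousOn (fun p : EuclideanSpace ℝ (Fin n) × ℝ => u p.2 p.1)
        (Set.univ ×ˢ Set.Icc 0 T) ∧
      ∃ M : ℝ, ∀ t ∈ Set.Icc (0:ℝ) T, ∀ x, |u t x| ≤ M) ∧
    ∀ t : ℝ, 0 < t → ∀ x, u t x =
      heatOp n t φ x + ∫ s in (0:ℝ)..t, heatOp n (t - s) (fun y => f (u s y) ‖y‖) x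

/-- The weight `w(x)`. -/
def weightW (n : ℕ) (ν a : ℝ) (x : EuclideanSpace ℝ (Fin n)) : ℝ :=
  if ‖x‖ ≤ 1 then ‖x‖ ^ ν else ‖x‖ ^ a

/-- The weighted `L^∞` norm `‖φ‖_X = ‖φ · w‖_∞`. -/
def XNorm (n : ℕ) (ν a : ℝ) (φ : EuclideanSpace ℝ (Fin n) → ℝ) : ENNReal :=
  essSup (fun x => ENNReal.ofReal (|φ x| * weightW n ν a x)) volume

/-- The mild (Duhamel) equation on `(ℝⁿ \ {0}) × [0, T]`. -/
def MildEq (n : ℕ) (f : ℝ → ℝ → ℝ) (φ : EuclideanSpace ℝ (Fin n) → ℝ)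
    (u : ℝ → EuclideanSpace ℝ (Fin n) → ℝ) (T : ℝ) : Prop :=
  (∀ x : EuclideanSpace ℝ (Fin n), x ≠ 0 → u 0 x = φ x) ∧
    ∀ t : ℝ, 0 < t → t ≤ T → ∀ x : EuclideanSpace ℝ (Fin n), x ≠ 0 →
      u t x = heatOp n t φ x +
        ∫ s in (0:ℝ)..t, heatOp n (t - s) (fun y => f (u s y) ‖y‖) x

/-- A mild solution on `[0,T]` with weighted norm bounded by `ρ`. -/
def MildSol (n : ℕ) (f : ℝ → ℝ → ℝ) (ν a : ℝ) (φ : EuclideanSpace ℝ (Fin n) → ℝ)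
    (ρ T : ℝ) (u : ℝ → EuclideanSpace ℝ (Fin n) → ℝ) : Prop :=
  MildEq n f φ u T ∧ ∀ t ∈ Set.Icc (0:ℝ) T, XNorm n ν a (u t) ≤ ENNReal.ofReal ρ

end Paper

namespace Aux

open Paper

/-- Rescaled form of the heat operator, defined for all `τ`. -/
def gH (n : ℕ) (τ : ℝ) (ψ : EuclideanSpace ℝ (Fin n) → ℝ)
    (x : EuclideanSpace ℝ (Fin n)) : ℝ :=
  (4 * Real.pi) ^ (-(n : ℝ) / 2) *
    ∫ z : EuclideanSpace ℝ (Fin n), Real.exp (-‖z‖ ^ 2 / 4) * ψ (x + √τ • z)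

lemma heatOp_eq (n : ℕ) {τ : ℝ} (hτ : 0 < τ) (ψ : EuclideanSpace ℝ (Fin n) → ℝ)
    (x : EuclideanSpace ℝ (Fin n)) : heatOp n τ ψ x = gH n τ ψ x := by
  unfold heatOp gH
  have hs : 0 < √τ := Real.sqrt_pos.2 hτ
  have h1 := MeasureTheory.Measure.integral_comp_smul
    (volume : Measure (EuclideanSpace ℝ (Fin n)))
    (fun v => Real.exp (-‖v‖ ^ 2 / (4 * τ)) * ψ (x + v)) (√τ)
  have h2 := MeasureTheory.integral_add_left_eq_self (μ := (volume : Measure (EuclideanSpace ℝ (Fin n))))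
    (fun y => Real.exp (-‖x - y‖ ^ 2 / (4 * τ)) * ψ y) x
  rw [← h2]
  have h3 : ∀ z : EuclideanSpace ℝ (Fin n),
      Real.exp (-‖√τ • z‖ ^ 2 / (4 * τ)) * ψ (x + √τ • z)
        = Real.exp (-‖z‖ ^ 2 / 4) * ψ (x + √τ • z) := by
    intro z
    congr 2
    rw [norm_smul, Real.norm_of_nonneg hs.le, mul_pow, Real.sq_sqrt hτ.le]
    field_simp
  simp only [h3] at h1
  rw [h1]
  have h4 : ∀ z : EuclideanSpace ℝ (Fin n), ‖x - (x + z)‖ = ‖z‖ := by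
    intro z; rw [sub_add_cancel_left, norm_neg]
  simp only [h4, smul_eq_mul, finrank_euclideanSpace, Fintype.card_fin]
  rw [← mul_assoc]
  congr 1
  rw [Real.mul_rpow (by positivity) hτ.le, abs_of_pos (by positivity)]
  congr 1
  rw [Real.sqrt_eq_rpow, ← Real.rpow_natCast, ← Real.rpow_mul hτ.le, ← Real.rpow_neg hτ.le]
  congr 1
  ring

lemma integrable_gauss (n : ℕ) {b : ℝ} (hb : 0 < b) :
    Integrable (fun z : EuclideanSpace ℝ (Fin n) => Real.exp (-b * ‖z‖ ^ 2)) := by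
  have h := (GaussianFourier.integrable_cexp_neg_mul_sq_norm_add (b := (b : ℂ))
    (by simpa using hb) 0 (0 : EuclideanSpace ℝ (Fin n))).re
  refine h.congr (Filter.Eventually.of_forall fun z => ?_)
  simp only [zero_mul, add_zero]
  have : (-(b:ℂ) * (‖z‖:ℂ) ^ 2) = ((-b * ‖z‖ ^ 2 : ℝ) : ℂ) := by push_cast; ring
  rw [this, ← Complex.ofReal_exp]
  exact Complex.ofReal_re _

lemma integrable_gauss_lin (n : ℕ) :
    Integrable (fun z : EuclideanSpace ℝ (Fin n) => Real.exp (-‖z‖ ^ 2 / 4) * (1 + ‖z‖)) := by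
  refine ((integrable_gauss n (b := 1/8) (by norm_num)).const_mul 4).mono'
    (by fun_prop) (Filter.Eventually.of_forall fun z => ?_)
  rw [Real.norm_of_nonneg (by positivity)]
  have h1 : 1 + ‖z‖ ≤ 4 * Real.exp (‖z‖ ^ 2 / 8) := by
    have := Real.add_one_le_exp (‖z‖ ^ 2 / 8)
    nlinarith [sq_nonneg (‖z‖ - 1)]
  calc Real.exp (-‖z‖ ^ 2 / 4) * (1 + ‖z‖)
      ≤ Real.exp (-‖z‖ ^ 2 / 4) * (4 * Real.exp (‖z‖ ^ 2 / 8)) := by gcongr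
    _ = 4 * Real.exp (-(1/8) * ‖z‖ ^ 2) := by
      rw [mul_left_comm, ← Real.exp_add]; congr 2; ring

lemma lin_bound {n : ℕ} {ψ : EuclideanSpace ℝ (Fin n) → ℝ} {C : ℝ}
    (hb : ∀ y, |ψ y| ≤ C * (1 + ‖y‖)) {x z : EuclideanSpace ℝ (Fin n)} {r K : ℝ}
    (hr : |r| ≤ K) (hx : ‖x‖ ≤ K) (hK : 0 ≤ K) :
    ‖Real.exp (-‖z‖ ^ 2 / 4) * ψ (x + r • z)‖ ≤
      C * (1 + K) * (Real.exp (-‖z‖ ^ 2 / 4) * (1 + ‖z‖)) := by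
  have hC : 0 ≤ C := by
    have := (abs_nonneg _).trans (hb 0)
    simpa using this
  rw [norm_mul, Real.norm_of_nonneg (Real.exp_pos _).le, Real.norm_eq_abs]
  have h1 : ‖x + r • z‖ ≤ K + K * ‖z‖ := by
    refine (norm_add_le _ _).trans ?_
    rw [norm_smul, Real.norm_eq_abs]
    gcongr
  calc Real.exp (-‖z‖ ^ 2 / 4) * |ψ (x + r • z)|
      ≤ Real.exp (-‖z‖ ^ 2 / 4) * (C * (1 + (K + K * ‖z‖))) := by
        gcongr
        exact (hb _).trans (by gcongr)
    _ ≤ Real.exp (-‖z‖ ^ 2 / 4) * (C * ((1 + K) * (1 + ‖z‖))) := by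
        gcongr
        nlinarith [norm_nonneg z]
    _ = _ := by ring

lemma integrable_gH {n : ℕ} {ψ : EuclideanSpace ℝ (Fin n) → ℝ} {C : ℝ}
    (hc : Continuous ψ) (hb : ∀ y, |ψ y| ≤ C * (1 + ‖y‖)) (x : EuclideanSpace ℝ (Fin n)) (r : ℝ) :
    Integrable (fun z : EuclideanSpace ℝ (Fin n) =>
      Real.exp (-‖z‖ ^ 2 / 4) * ψ (x + r • z)) := by
  refine ((integrable_gauss_lin n).const_mul (C * (1 + (|r| + ‖x‖)))).mono' ?_
    (Filter.Eventually.of_forall fun z => ?_)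
  · exact Continuous.aestronglyMeasurable (by fun_prop)
  · exact lin_bound hb (by linarith [norm_nonneg x]) (by linarith [abs_nonneg r])
      (by positivity)

lemma continuous_gH {n : ℕ} {g : ℝ × EuclideanSpace ℝ (Fin n) → ℝ} {C : ℝ}
    (hc : Continuous g) (hb : ∀ s y, |g (s, y)| ≤ C * (1 + ‖y‖)) :
    Continuous (fun p : ℝ × ℝ × EuclideanSpace ℝ (Fin n) =>
      gH n p.1 (fun y => g (p.2.1, y)) p.2.2) := by
  unfold gH
  refine continuous_const.mul ?_
  rw [continuous_iff_continuousAt]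
  intro p₀
  have h1 : ∀ᶠ p : ℝ × ℝ × EuclideanSpace ℝ (Fin n) in nhds p₀, √p.1 < √p₀.1 + 1 :=
    (Continuous.tendsto (f := fun p : ℝ × ℝ × EuclideanSpace ℝ (Fin n) => √p.1)
      (by fun_prop) p₀).eventually_lt_const (by linarith)
  have h2 : ∀ᶠ p : ℝ × ℝ × EuclideanSpace ℝ (Fin n) in nhds p₀, ‖p.2.2‖ < ‖p₀.2.2‖ + 1 :=
    (Continuous.tendsto (f := fun p : ℝ × ℝ × EuclideanSpace ℝ (Fin n) => ‖p.2.2‖)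
      (by fun_prop) p₀).eventually_lt_const (by linarith)
  refine MeasureTheory.continuousAt_of_dominated
    (bound := fun z => C * (1 + (√p₀.1 + 1 + (‖p₀.2.2‖ + 1))) *
      (Real.exp (-‖z‖ ^ 2 / 4) * (1 + ‖z‖))) ?_ ?_ ((integrable_gauss_lin n).const_mul _) ?_
  · refine Filter.Eventually.of_forall fun p => Continuous.aestronglyMeasurable ?_
    fun_prop
  · filter_upwards [h1, h2] with p hp1 hp2
    refine Filter.Eventually.of_forall fun z => ?_
    refine lin_bound (ψ := fun y => g (p.2.1, y)) (hb p.2.1) ?_ ?_ (by positivity)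
    · rw [abs_of_nonneg (Real.sqrt_nonneg _)]
      linarith [norm_nonneg p₀.2.2]
    · linarith [Real.sqrt_nonneg p₀.1]
  · refine Filter.Eventually.of_forall fun z => Continuous.continuousAt ?_
    fun_prop

lemma gH_mono {n : ℕ} {ψ₁ ψ₂ : EuclideanSpace ℝ (Fin n) → ℝ} {C₁ C₂ : ℝ}
    (hc₁ : Continuous ψ₁) (hb₁ : ∀ y, |ψ₁ y| ≤ C₁ * (1 + ‖y‖))
    (hc₂ : Continuous ψ₂) (hb₂ : ∀ y, |ψ₂ y| ≤ C₂ * (1 + ‖y‖))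
    (h : ∀ y, ψ₁ y ≤ ψ₂ y) (τ : ℝ) (x : EuclideanSpace ℝ (Fin n)) :
    gH n τ ψ₁ x ≤ gH n τ ψ₂ x := by
  unfold gH
  refine mul_le_mul_of_nonneg_left ?_ (by positivity)
  refine integral_mono (integrable_gH hc₁ hb₁ x _) (integrable_gH hc₂ hb₂ x _) fun z => ?_
  exact mul_le_mul_of_nonneg_left (h _) (Real.exp_pos _).le

lemma gH_sub {n : ℕ} {ψ₁ ψ₂ : EuclideanSpace ℝ (Fin n) → ℝ} {C₁ C₂ : ℝ}
    (hc₁ : Continuous ψ₁) (hb₁ : ∀ y, |ψ₁ y| ≤ C₁ * (1 + ‖y‖))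
    (hc₂ : Continuous ψ₂) (hb₂ : ∀ y, |ψ₂ y| ≤ C₂ * (1 + ‖y‖))
    (τ : ℝ) (x : EuclideanSpace ℝ (Fin n)) :
    gH n τ ψ₁ x - gH n τ ψ₂ x = gH n τ (fun y => ψ₁ y - ψ₂ y) x := by
  unfold gH
  rw [← mul_sub, ← integral_sub (integrable_gH hc₁ hb₁ x _) (integrable_gH hc₂ hb₂ x _)]
  simp only [mul_sub]

lemma gH_const_mul (n : ℕ) (c : ℝ) (ψ : EuclideanSpace ℝ (Fin n) → ℝ)
    (τ : ℝ) (x : EuclideanSpace ℝ (Fin n)) :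
    gH n τ (fun y => c * ψ y) x = c * gH n τ ψ x := by
  unfold gH
  have h : ∀ z : EuclideanSpace ℝ (Fin n), Real.exp (-‖z‖ ^ 2 / 4) * (c * ψ (x + √τ • z)) =
      c * (Real.exp (-‖z‖ ^ 2 / 4) * ψ (x + √τ • z)) := fun z => by ring
  simp only [h]
  rw [integral_const_mul]
  ring

lemma gH_const (n : ℕ) (c τ : ℝ) (x : EuclideanSpace ℝ (Fin n)) :
    gH n τ (fun _ => c) x = c := by
  unfold gH
  rw [integral_mul_const]
  have h : ∀ z : EuclideanSpace ℝ (Fin n), -‖z‖ ^ 2 / 4 = -(1/4) * ‖z‖ ^ 2 := by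
    intro z; ring
  simp only [h]
  rw [GaussianFourier.integral_rexp_neg_mul_sq_norm (by norm_num), finrank_euclideanSpace,
    Fintype.card_fin, ← mul_assoc]
  have : Real.pi / (1/4) = 4 * Real.pi := by ring
  rw [this, ← Real.rpow_add (by positivity)]
  have h2 : -(n:ℝ) / 2 + n / 2 = 0 := by ring
  rw [h2, Real.rpow_zero, one_mul]

lemma heatOp_congr {n : ℕ} {ψ₁ ψ₂ : EuclideanSpace ℝ (Fin n) → ℝ} (hn : 0 < n)
    (h : ∀ y, y ≠ 0 → ψ₁ y = ψ₂ y) (τ : ℝ) (x : EuclideanSpace ℝ (Fin n)) :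
    heatOp n τ ψ₁ x = heatOp n τ ψ₂ x := by
  unfold heatOp
  have : Nonempty (Fin n) := ⟨⟨0, hn⟩⟩
  congr 1
  apply integral_congr_ae
  have : ∀ᵐ y : EuclideanSpace ℝ (Fin n), y ≠ 0 := by
    simp [ae_iff]
  filter_upwards [this] with y hy
  rw [h y hy]

/-- Spreading Gaussian. -/
def VV (n : ℕ) (M σ s : ℝ) (y : EuclideanSpace ℝ (Fin n)) : ℝ :=
  M * ((σ + s) / σ) ^ (-(n : ℝ) / 2) * Real.exp (-‖y‖ ^ 2 / (4 * (σ + s)))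

lemma gH_VV (n : ℕ) {M σ s τ : ℝ} (hσ : 0 < σ) (hs : 0 ≤ s) (hτ : 0 < τ)
    (x : EuclideanSpace ℝ (Fin n)) : gH n τ (VV n M σ s) x = VV n M σ (s + τ) x := by
  rw [← heatOp_eq n hτ]
  unfold heatOp VV
  set a := σ + s with ha
  have hapos : 0 < a := by positivity
  have haτ : σ + (s + τ) = a + τ := by rw [ha]; ring
  rw [haτ]
  have h1 : ∀ y : EuclideanSpace ℝ (Fin n),
      Real.exp (-‖x - y‖ ^ 2 / (4 * τ)) * (M * (a / σ) ^ (-(n : ℝ) / 2) * Real.exp (-‖y‖ ^ 2 / (4 * a)))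
      = (M * (a / σ) ^ (-(n : ℝ) / 2) * Real.exp (-‖x‖ ^ 2 / (4 * (a + τ)))) *
        Real.exp (-((a + τ) / (4 * a * τ)) * ‖-((a / (a + τ)) • x) + y‖ ^ 2) := by
    intro y
    rw [mul_left_comm, ← Real.exp_add, mul_assoc (M * _), ← Real.exp_add]
    congr 2
    have e1 : ‖x - y‖ ^ 2 = ‖x‖ ^ 2 - 2 * inner ℝ x y + ‖y‖ ^ 2 := norm_sub_sq_real x y
    have e2 : ‖-((a / (a + τ)) • x) + y‖ ^ 2 =
        (a / (a + τ)) ^ 2 * ‖x‖ ^ 2 - 2 * ((a / (a + τ)) * inner ℝ x y) + ‖y‖ ^ 2 := by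
      rw [norm_add_sq_real, norm_neg, norm_smul, inner_neg_left, real_inner_smul_left, mul_pow,
        Real.norm_eq_abs, sq_abs]
      ring
    rw [e1, e2]
    field_simp
    ring
  simp only [h1]
  rw [integral_const_mul, MeasureTheory.integral_add_left_eq_self
    (fun y : EuclideanSpace ℝ (Fin n) => Real.exp (-((a + τ) / (4 * a * τ)) * ‖y‖ ^ 2)),
    GaussianFourier.integral_rexp_neg_mul_sq_norm (by positivity), finrank_euclideanSpace,
    Fintype.card_fin]
  have e3 : Real.pi / ((a + τ) / (4 * a * τ)) = (4 * Real.pi * τ) * (a / (a + τ)) := by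
    field_simp
  have e4 : (a + τ) / σ = (a / σ) / (a / (a + τ)) := by field_simp
  have e5 : -(n : ℝ) / 2 = -((n : ℝ) / 2) := by ring
  have r1 : (4 * Real.pi * τ * (a / (a + τ))) ^ ((n : ℝ) / 2) =
      (4 * Real.pi * τ) ^ ((n : ℝ) / 2) * (a / (a + τ)) ^ ((n : ℝ) / 2) :=
    Real.mul_rpow (by positivity) (by positivity)
  have r2 : (a / σ / (a / (a + τ))) ^ (-((n : ℝ) / 2)) =
      (a / σ) ^ (-((n : ℝ) / 2)) / (a / (a + τ)) ^ (-((n : ℝ) / 2)) :=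
    Real.div_rpow (by positivity) (by positivity) _
  have r3 : (a / (a + τ)) ^ (-((n : ℝ) / 2)) = ((a / (a + τ)) ^ ((n : ℝ) / 2))⁻¹ :=
    Real.rpow_neg (by positivity) _
  have r4 : (4 * Real.pi * τ) ^ (-((n : ℝ) / 2)) = ((4 * Real.pi * τ) ^ ((n : ℝ) / 2))⁻¹ :=
    Real.rpow_neg (by positivity) _
  rw [e3, e4, e5, r1, r2, r3, r4]
  generalize (a / σ) ^ (-((n : ℝ) / 2)) = Q
  have p1 : 0 < (4 * Real.pi * τ) ^ ((n : ℝ) / 2) := by positivity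
  have p2 : 0 < (a / (a + τ)) ^ ((n : ℝ) / 2) := by positivity
  field_simp

lemma gH_nonneg {n : ℕ} {ψ : EuclideanSpace ℝ (Fin n) → ℝ} (h : ∀ y, 0 ≤ ψ y) (τ : ℝ)
    (x : EuclideanSpace ℝ (Fin n)) : 0 ≤ gH n τ ψ x := by
  unfold gH
  refine mul_nonneg (by positivity) (integral_nonneg fun z => ?_)
  exact mul_nonneg (Real.exp_pos _).le (h _)

lemma gH_ball_lower (n : ℕ) : ∃ a : ℝ, 0 < a ∧ ∀ (ψ : EuclideanSpace ℝ (Fin n) → ℝ) (C : ℝ),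
    Continuous ψ → (∀ y, |ψ y| ≤ C * (1 + ‖y‖)) → (∀ y, 0 ≤ ψ y) →
    ∀ (x₀ : EuclideanSpace ℝ (Fin n)) (R m : ℝ), 0 < R → 0 ≤ m →
    (∀ y ∈ Metric.closedBall x₀ R, m ≤ ψ y) → ∀ x ∈ Metric.closedBall x₀ R, ∀ τ : ℝ,
    τ ≤ R ^ 2 → a * m ≤ gH n τ ψ x := by
  set v : ℝ := (volume : Measure (EuclideanSpace ℝ (Fin n))).real (Metric.ball 0 (1/2)) with hv
  have hvpos : 0 < v :=
    ENNReal.toReal_pos (Metric.measure_ball_pos _ _ (by norm_num)).ne' measure_ball_lt_top.ne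
  refine ⟨(4 * Real.pi) ^ (-(n : ℝ) / 2) * (Real.exp (-1/4) * v), by positivity, ?_⟩
  intro ψ C hc hb h0 x₀ R m hR hm hB x hx τ hτR
  unfold gH
  rw [mul_assoc]
  refine mul_le_mul_of_nonneg_left ?_ (by positivity)
  have hsR : √τ ≤ R := by
    rw [show R = √(R^2) from (Real.sqrt_sq hR.le).symm]
    exact Real.sqrt_le_sqrt hτR
  have hs0 := Real.sqrt_nonneg τ
  set z₀ : EuclideanSpace ℝ (Fin n) := (1 / (2 * R)) • (x₀ - x) with hz₀
  have hxx : ‖x₀ - x‖ ≤ R := by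
    rw [← dist_eq_norm, dist_comm]; exact hx
  have hz0n : ‖z₀‖ ≤ 1/2 := by
    rw [hz₀, norm_smul, Real.norm_of_nonneg (by positivity)]
    rw [div_mul_eq_mul_div, one_mul, div_le_div_iff₀ (by positivity) (by norm_num)]
    linarith
  have hmem : ∀ z ∈ Metric.ball z₀ (1/2), ‖z‖ ≤ 1 ∧ x + √τ • z ∈ Metric.closedBall x₀ R := by
    intro z hz
    have hz' : ‖z - z₀‖ < 1/2 := by simpa [dist_eq_norm] using hz
    constructor
    · calc ‖z‖ = ‖z₀ + (z - z₀)‖ := by congr 1; abel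
        _ ≤ ‖z₀‖ + ‖z - z₀‖ := norm_add_le _ _
        _ ≤ 1 := by linarith
    · rw [mem_closedBall_iff_norm]
      have e : x + √τ • z - x₀ = (1 - √τ / (2 * R)) • (x - x₀) + √τ • (z - z₀) := by
        rw [hz₀]
        module
      rw [e]
      refine (norm_add_le _ _).trans ?_
      have h1 : √τ / (2 * R) ≤ 1 := by
        rw [div_le_one (by positivity)]; linarith
      rw [norm_smul, norm_smul, Real.norm_of_nonneg (by linarith), Real.norm_of_nonneg hs0,
        norm_sub_rev x x₀]
      calc (1 - √τ / (2 * R)) * ‖x₀ - x‖ + √τ * ‖z - z₀‖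
          ≤ (1 - √τ / (2 * R)) * R + √τ * (1/2) := by
            have : 0 ≤ 1 - √τ / (2 * R) := by linarith
            gcongr
        _ = R := by field_simp; ring
  have hintg := integrable_gH hc hb x (√τ)
  have hvol : (volume : Measure (EuclideanSpace ℝ (Fin n))).real (Metric.ball z₀ (1/2)) = v := by
    rw [hv, measureReal_def, measureReal_def, Measure.addHaar_ball_center]
  calc Real.exp (-1/4) * v * m
      = ∫ _z in Metric.ball z₀ (1/2), Real.exp (-1/4) * m := by
        rw [setIntegral_const, hvol, smul_eq_mul]; ring
    _ ≤ ∫ z in Metric.ball z₀ (1/2), Real.exp (-‖z‖ ^ 2 / 4) * ψ (x + √τ • z) := by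
        refine setIntegral_mono_on ?_ hintg.integrableOn measurableSet_ball ?_
        · exact integrableOn_const measure_ball_lt_top.ne
        · intro z hz
          obtain ⟨h1, h2⟩ := hmem z hz
          refine mul_le_mul ?_ (hB _ h2) hm (Real.exp_pos _).le
          apply Real.exp_le_exp.2
          nlinarith [norm_nonneg z]
    _ ≤ ∫ z, Real.exp (-‖z‖ ^ 2 / 4) * ψ (x + √τ • z) :=
        setIntegral_le_integral hintg (Filter.Eventually.of_forall fun z =>
          mul_nonneg (Real.exp_pos _).le (h0 _))

/-- A lower bound on an interval part gives a lower bound on the integral. -/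
lemma integral_lower {h : ℝ → ℝ} (hc : Continuous h) {t₀ t m : ℝ} (h0 : 0 ≤ t₀) (ht : t₀ ≤ t)
    (hnn : ∀ s, 0 ≤ h s) (hm : ∀ s ∈ Icc t₀ t, m ≤ h s) :
    m * (t - t₀) ≤ ∫ s in (0:ℝ)..t, h s := by
  rw [← intervalIntegral.integral_add_adjacent_intervals
    (hc.intervalIntegrable 0 t₀) (hc.intervalIntegrable t₀ t)]
  have h1 : 0 ≤ ∫ s in (0:ℝ)..t₀, h s :=
    intervalIntegral.integral_nonneg h0 fun s _ => hnn s
  have h2 : ∫ _s in t₀..t, m ≤ ∫ s in t₀..t, h s :=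
    intervalIntegral.integral_mono_on ht (by simp) (hc.intervalIntegrable t₀ t) hm
  rw [intervalIntegral.integral_const, smul_eq_mul] at h2
  linarith

lemma blowup_core (n : ℕ) (hn : 0 < n) : ∃ a : ℝ, 0 < a ∧
    ∀ (p C : ℝ) (kt : ℝ → ℝ) (f : ℝ → ℝ → ℝ), 1 < p → Continuous kt → (∀ r, 0 ≤ kt r) →
    (∀ r, 0 ≤ r → kt r ≤ C * (1 + r)) →
    (∀ u r, 0 < r → f u r = kt r * |u| ^ p) →
    ∀ (x₀ : EuclideanSpace ℝ (Fin n)) (R κ c : ℝ), 0 < R → 0 < κ → 0 < c →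
    (∀ y ∈ Metric.closedBall x₀ R, κ ≤ kt ‖y‖) →
    2 ≤ a * κ * c ^ (p - 1) * R ^ 2 * (1 - 2 ^ (1 - p)) →
    ¬ ∃ u : ℝ → EuclideanSpace ℝ (Fin n) → ℝ, CBMildGlobal n f (fun _ => c) u := by
  obtain ⟨a, ha, hlow⟩ := gH_ball_lower n
  refine ⟨a, ha, ?_⟩
  rintro p C kt f hp hkc hk0 hkC hf x₀ R κ c hR hκ hc hκB hbig ⟨u, hu0, hucont, humild⟩
  set S : ℝ := R ^ 2 with hS
  have hSpos : 0 < S := by positivity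
  obtain ⟨hcont, M, hM⟩ := hucont S hSpos
  set cl : ℝ → ℝ := fun s => max 0 (min s S) with hcl
  have hclmem : ∀ s, cl s ∈ Icc 0 S := fun s =>
    ⟨le_max_left _ _, max_le hSpos.le (min_le_right _ _)⟩
  have hcleq : ∀ s ∈ Icc 0 S, cl s = s := by
    rintro s ⟨h1, h2⟩
    simp [hcl, h1, h2]
  have hucl : Continuous (fun q : ℝ × EuclideanSpace ℝ (Fin n) => u (cl q.1) q.2) := by
    refine hcont.comp_continuous (f := fun q : ℝ × EuclideanSpace ℝ (Fin n) => (q.2, cl q.1))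
      (by fun_prop) ?_
    intro q
    exact ⟨mem_univ _, hclmem _⟩
  have hMnn : 0 ≤ M := (abs_nonneg _).trans (hM 0 ⟨le_rfl, hSpos.le⟩ 0)
  set g : ℝ × EuclideanSpace ℝ (Fin n) → ℝ :=
    fun q => kt ‖q.2‖ * |u (cl q.1) q.2| ^ p with hg
  have hgc : Continuous g := by
    refine (hkc.comp continuous_snd.norm).mul ?_
    exact hucl.abs.rpow_const fun _ => Or.inr (by linarith)
  have hg0 : ∀ s y, 0 ≤ g (s, y) := fun s y => mul_nonneg (hk0 _) (by positivity)
  have hgb : ∀ s y, |g (s, y)| ≤ (C * M ^ p) * (1 + ‖y‖) := by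
    intro s y
    rw [abs_of_nonneg (hg0 s y)]
    have h1 : |u (cl s) y| ^ p ≤ M ^ p :=
      Real.rpow_le_rpow (abs_nonneg _) (hM _ (hclmem s) y) (by linarith)
    calc kt ‖y‖ * |u (cl s) y| ^ p ≤ (C * (1 + ‖y‖)) * M ^ p :=
          mul_le_mul (hkC _ (norm_nonneg y)) h1 (by positivity)
            ((hk0 _).trans (hkC _ (norm_nonneg y)))
      _ = _ := by ring
  have hHc : ∀ t x, Continuous fun s => gH n (t - s) (fun y => g (s, y)) x := by
    intro t x
    exact (continuous_gH hgc hgb).comp (f := fun s : ℝ => (t - s, s, x)) (by fun_prop)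
  have hform : ∀ t ∈ Ioc 0 S, ∀ x, u t x =
      c + ∫ s in (0:ℝ)..t, gH n (t - s) (fun y => g (s, y)) x := by
    rintro t ⟨ht0, htS⟩ x
    rw [humild t ht0 x, heatOp_eq n ht0, gH_const]
    congr 1
    rw [intervalIntegral.integral_of_le ht0.le, intervalIntegral.integral_of_le ht0.le,
      integral_Ioc_eq_integral_Ioo, integral_Ioc_eq_integral_Ioo]
    refine setIntegral_congr_fun measurableSet_Ioo ?_
    rintro s ⟨hs0, hst⟩
    simp only
    rw [← heatOp_eq n (sub_pos.2 hst)]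
    apply heatOp_congr hn
    intro y hy
    rw [hf _ _ (norm_pos_iff.2 hy), hg]
    simp only
    rw [hcleq s ⟨hs0.le, by linarith⟩]
  set ρ : ℝ := 2 ^ (1 - p) with hρ
  have hρ0 : 0 < ρ := by positivity
  have hρ1 : ρ < 1 := Real.rpow_lt_one_of_one_lt_of_neg (by norm_num) (by linarith)
  have key : ∀ j : ℕ, ∀ t ∈ Icc (S * (1 - ρ ^ j)) S, ∀ x ∈ Metric.closedBall x₀ R,
      2 ^ j * c ≤ u t x := by
    intro j
    induction j with
    | zero =>
      rintro t ⟨ht0, htS⟩ x hx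
      simp only [pow_zero, sub_self, mul_zero, one_mul] at ht0 ⊢
      rcases ht0.eq_or_lt with h | h
      · rw [← h, hu0]
      · rw [hform t ⟨h, htS⟩]
        have : 0 ≤ ∫ s in (0:ℝ)..t, gH n (t - s) (fun y => g (s, y)) x :=
          intervalIntegral.integral_nonneg ht0 fun s _ => gH_nonneg (hg0 s) _ _
        linarith
    | succ j ih =>
      rintro t ⟨ht0, htS⟩ x hx
      have hρj : 0 < ρ ^ j := by positivity
      have hρj1 : ρ ^ j ≤ 1 := pow_le_one₀ hρ0.le hρ1.le
      have hdiff : S * ρ ^ j * (1 - ρ) ≤ t - S * (1 - ρ ^ j) := by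
        rw [pow_succ] at ht0; nlinarith
      have hd0 : 0 < S * ρ ^ j * (1 - ρ) := by
        have : 0 < 1 - ρ := by linarith
        positivity
      have ht0' : 0 ≤ S * (1 - ρ ^ j) := mul_nonneg hSpos.le (by linarith)
      rw [hform t ⟨by linarith, htS⟩]
      have hl := integral_lower (hHc t x) (t₀ := S * (1 - ρ ^ j)) (t := t)
        (m := a * (κ * (2 ^ j * c) ^ p)) ht0' (by linarith)
        (fun s => gH_nonneg (hg0 s) _ _) (by
          rintro s ⟨hs0, hst⟩
          refine hlow (fun y => g (s, y)) _ (by fun_prop) (hgb s) (hg0 s) x₀ R _ hR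
            (by positivity) ?_ x hx (t - s) (by linarith)
          intro y hy
          simp only [hg]
          rw [hcleq s ⟨by linarith, by linarith⟩]
          refine mul_le_mul (hκB y hy) ?_ (by positivity) (hk0 _)
          refine Real.rpow_le_rpow (by positivity) ?_ (by linarith)
          exact (ih s ⟨hs0, by linarith⟩ y hy).trans (le_abs_self _))
      have e1 : ((2:ℝ) ^ j * c) ^ p * ρ ^ j = c ^ (p - 1) * (2 ^ j * c) := by
        have h2j : (0:ℝ) < 2 ^ j := by positivity
        rw [Real.mul_rpow h2j.le hc.le, hρ, ← Real.rpow_natCast, ← Real.rpow_natCast,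
          ← Real.rpow_mul (by norm_num), ← Real.rpow_mul (by norm_num)]
        have h3 : (2:ℝ) ^ ((j:ℝ) * p) * 2 ^ ((1 - p) * (j:ℝ)) = 2 ^ (j:ℝ) := by
          rw [← Real.rpow_add (by norm_num)]; congr 1; ring
        have h4 : c ^ p = c ^ (p - 1) * c := by
          rw [← Real.rpow_add_one hc.ne']; congr 1; ring
        rw [h4]
        linear_combination (c ^ (p - 1) * c) * h3
      have e2 : a * (κ * (2 ^ j * c) ^ p) * (S * ρ ^ j * (1 - ρ)) =
          (a * κ * c ^ (p - 1) * S * (1 - ρ)) * (2 ^ j * c) := by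
        linear_combination (a * κ * S * (1 - ρ)) * e1
      have e3 : 2 * (2 ^ j * c) ≤ a * (κ * (2 ^ j * c) ^ p) * (S * ρ ^ j * (1 - ρ)) := by
        rw [e2]
        exact mul_le_mul_of_nonneg_right hbig (by positivity)
      have e4 : a * (κ * (2 ^ j * c) ^ p) * (S * ρ ^ j * (1 - ρ)) ≤
          a * (κ * (2 ^ j * c) ^ p) * (t - S * (1 - ρ ^ j)) :=
        mul_le_mul_of_nonneg_left hdiff (by positivity)
      rw [pow_succ]
      linarith
  obtain ⟨j, hj⟩ := pow_unbounded_of_one_lt (M / c) (one_lt_two : (1:ℝ) < 2)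
  rw [div_lt_iff₀ hc] at hj
  have h1 := key j S ⟨by
    have : 0 < ρ ^ j := by positivity
    nlinarith, le_rfl⟩ x₀ (Metric.mem_closedBall_self hR.le)
  have h2 := hM S ⟨hSpos.le, le_rfl⟩ x₀
  linarith [le_abs_self (u S x₀)]

lemma gH_VV' (n : ℕ) {M σ s τ : ℝ} (hσ : 0 < σ) (hs : 0 ≤ s) (hτ : 0 ≤ τ)
    (x : EuclideanSpace ℝ (Fin n)) : gH n τ (VV n M σ s) x = VV n M σ (s + τ) x := by
  rcases hτ.eq_or_lt with h | h
  · subst h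
    have h1 := gH_const n (VV n M σ s x) 0 x
    unfold gH at h1 ⊢
    simpa using h1
  · exact gH_VV n hσ hs h x

lemma rpow_exp_bound {e b : ℝ} (he : 0 ≤ e) (hb : 0 < b) : ∃ C : ℝ, 0 ≤ C ∧ ∀ r T : ℝ, 0 ≤ r →
    0 < T → r ^ e * Real.exp (-(b * r ^ 2 / T)) ≤ C * T ^ (e / 2) := by
  rcases he.eq_or_lt with h | h
  · subst h
    refine ⟨1, zero_le_one, fun r T hr hT => ?_⟩
    simp only [Real.rpow_zero, zero_div, one_mul]
    apply Real.exp_le_one_iff.2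
    have : 0 ≤ b * r ^ 2 / T := by positivity
    linarith
  · refine ⟨(e / 2 / b) ^ (e / 2), by positivity, fun r T hr hT => ?_⟩
    have h1 : b * r ^ 2 / T / (e / 2) ≤ Real.exp (b * r ^ 2 / T / (e / 2)) := by
      have := Real.add_one_le_exp (b * r ^ 2 / T / (e / 2))
      linarith
    have h2 := Real.rpow_le_rpow (by positivity) h1 (by positivity : 0 ≤ e / 2)
    rw [← Real.exp_mul, div_mul_cancel₀ _ (by positivity)] at h2
    have h3 : r ^ e = (e / 2 / b) ^ (e / 2) * T ^ (e / 2) * (b * r ^ 2 / T / (e / 2)) ^ (e / 2) := by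
      rw [← Real.mul_rpow (by positivity) (by positivity),
        ← Real.mul_rpow (by positivity) (by positivity)]
      have : e / 2 / b * T * (b * r ^ 2 / T / (e / 2)) = r ^ 2 := by field_simp
      rw [this, ← Real.rpow_natCast, ← Real.rpow_mul hr]
      congr 1
      push_cast; ring
    rw [h3, Real.exp_neg, ← div_eq_mul_inv, div_le_iff₀ (Real.exp_pos _)]
    gcongr

lemma trunc_lip {p : ℝ} (hp : 1 < p) (a b : ℝ) :
    |(min |a| 2) ^ p - (min |b| 2) ^ p| ≤ p * 2 ^ (p - 1) * |a - b| := by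
  have hd : ∀ x ∈ Icc (0:ℝ) 2, HasDerivAt (fun x : ℝ => x ^ p) (p * x ^ (p - 1)) x :=
    fun x _ => Real.hasDerivAt_rpow_const (Or.inr hp.le)
  have h := Convex.norm_image_sub_le_of_norm_deriv_le (𝕜 := ℝ) (f := fun x : ℝ => x ^ p)
    (s := Icc (0:ℝ) 2) (x := min |b| 2) (y := min |a| 2) (C := p * 2 ^ (p - 1))
    (fun x hx => (hd x hx).differentiableAt)
    (fun x hx => by
      rw [(hd x hx).deriv, Real.norm_of_nonneg
        (mul_nonneg (by linarith) (Real.rpow_nonneg hx.1 _))]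
      exact mul_le_mul_of_nonneg_left (Real.rpow_le_rpow hx.1 hx.2 (by linarith)) (by linarith))
    (convex_Icc 0 2) ⟨by positivity, min_le_right _ _⟩ ⟨by positivity, min_le_right _ _⟩
  simp only [Real.norm_eq_abs] at h
  refine h.trans (mul_le_mul_of_nonneg_left ?_ (by positivity))
  calc |min |a| 2 - min |b| 2| ≤ max |(|a| - |b|)| |2 - 2| := abs_min_sub_min_le_max _ _ _ _
    _ ≤ |a - b| := by simp [abs_abs_sub_abs_le]

lemma time_integral {N σ t : ℝ} (hN : 1 < N) (hσ : 0 < σ) (ht : 0 ≤ t) :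
    ∫ s in (0:ℝ)..t, ((σ + s) / σ) ^ (-N) ≤ σ / (N - 1) := by
  have hd : ∀ s ∈ uIcc 0 t, HasDerivAt
      (fun s => -(σ / (N - 1)) * ((σ + s) / σ) ^ (1 - N)) (((σ + s) / σ) ^ (-N)) s := by
    intro s hs
    rw [uIcc_of_le ht] at hs
    have hpos : 0 < (σ + s) / σ := by have := hs.1; positivity
    have h1 : HasDerivAt (fun s => (σ + s) / σ) (1 / σ) s :=
      ((hasDerivAt_id s).const_add σ).div_const σ
    have h2 := (h1.rpow_const (p := 1 - N) (Or.inl hpos.ne')).const_mul (-(σ / (N - 1)))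
    have e1 : 1 - N - 1 = -N := by ring
    have e2 : N - 1 ≠ 0 := by linarith
    have e3 : -(σ / (N - 1)) * (1 / σ * (1 - N) * ((σ + s) / σ) ^ (1 - N - 1)) =
        ((σ + s) / σ) ^ (-N) := by
      rw [e1]
      generalize ((σ + s) / σ) ^ (-N) = X
      field_simp
      ring
    rw [e3] at h2
    exact h2
  have hc : ContinuousOn (fun s => ((σ + s) / σ) ^ (-N)) (uIcc 0 t) := by
    rw [uIcc_of_le ht]
    intro s hs
    have hpos : 0 < (σ + s) / σ := by have := hs.1; positivity
    exact (ContinuousAt.rpow_const (f := fun s => (σ + s) / σ) (by fun_prop) (Or.inl hpos.ne')).continuousWithinAt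
  rw [intervalIntegral.integral_eq_sub_of_hasDerivAt hd hc.intervalIntegrable]
  simp only [add_zero, div_self hσ.ne', Real.one_rpow]
  have : 0 ≤ σ / (N - 1) * ((σ + t) / σ) ^ (1 - N) := by
    have : 0 < N - 1 := by linarith
    positivity
  linarith

lemma VV_pos {n : ℕ} {M σ s : ℝ} (hM : 0 < M) (hσ : 0 < σ) (hs : 0 ≤ s)
    (y : EuclideanSpace ℝ (Fin n)) : 0 < VV n M σ s y := by
  unfold VV; positivity

lemma VV_le {n : ℕ} {M σ s : ℝ} (hM : 0 < M) (hσ : 0 < σ) (hs : 0 ≤ s)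
    (y : EuclideanSpace ℝ (Fin n)) : VV n M σ s y ≤ M := by
  unfold VV
  have h1 : ((σ + s) / σ) ^ (-(n : ℝ) / 2) ≤ 1 := by
    apply Real.rpow_le_one_of_one_le_of_nonpos
    · rw [le_div_iff₀ hσ]; linarith
    · have : (0:ℝ) ≤ n := by positivity
      linarith
  have h2 : Real.exp (-‖y‖ ^ 2 / (4 * (σ + s))) ≤ 1 := by
    apply Real.exp_le_one_iff.2
    have : 0 ≤ ‖y‖ ^ 2 / (4 * (σ + s)) := by positivity
    rw [neg_div]; linarith
  calc M * ((σ + s) / σ) ^ (-(n : ℝ) / 2) * Real.exp (-‖y‖ ^ 2 / (4 * (σ + s)))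
      ≤ M * 1 * 1 := by gcongr
    _ = M := by ring

lemma VV_cont (n : ℕ) (M : ℝ) {σ : ℝ} (hσ : 0 < σ) :
    Continuous (fun q : ℝ × EuclideanSpace ℝ (Fin n) => VV n M σ (max q.1 0) q.2) := by
  unfold VV
  have hpos : ∀ q : ℝ × EuclideanSpace ℝ (Fin n), 0 < σ + max q.1 0 := fun q => by
    have := le_max_right q.1 0
    linarith
  refine (continuous_const.mul (Continuous.rpow_const (by fun_prop) ?_)).mul
    (Real.continuous_exp.comp (Continuous.div (by fun_prop) (by fun_prop) ?_))
  · intro q; exact Or.inl (div_pos (hpos q) hσ).ne'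
  · intro q; have := hpos q; positivity

lemma potential_bound (n : ℕ) {p C₀ e M : ℝ} (hp : 1 < p) (he : 0 ≤ e) (hM : 0 < M)
    {kt : ℝ → ℝ} (hk : ∀ r, 0 ≤ r → kt r ≤ C₀ * (1 + r ^ e)) (hC₀ : 0 ≤ C₀) :
    ∃ D : ℝ, 0 ≤ D ∧ ∀ σ s : ℝ, 0 < σ → σ ≤ 1 → 0 ≤ s → ∀ y : EuclideanSpace ℝ (Fin n),
      kt ‖y‖ * VV n M σ s y ^ (p - 1) ≤ D * ((σ + s) / σ) ^ (-((n : ℝ) * (p - 1) / 2 - e / 2)) := by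
  obtain ⟨C₁, hC₁, hb⟩ := rpow_exp_bound (e := e) (b := (p - 1) / 4) he (by linarith)
  refine ⟨C₀ * (1 + C₁) * M ^ (p - 1), by positivity, ?_⟩
  intro σ s hσ hσ1 hs y
  set Q := (σ + s) / σ with hQ
  have hQ1 : 1 ≤ Q := by rw [hQ, le_div_iff₀ hσ]; linarith
  have hQpos : 0 < Q := by linarith
  have hTQ : σ + s ≤ Q := by
    rw [hQ, le_div_iff₀ hσ]; nlinarith
  have hTpos : 0 < σ + s := by linarith
  have hV : VV n M σ s y ^ (p - 1) =
      M ^ (p - 1) * Q ^ (-(n : ℝ) / 2 * (p - 1)) * Real.exp (-((p - 1) / 4 * ‖y‖ ^ 2 / (σ + s))) := by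
    unfold VV
    rw [Real.mul_rpow (by positivity) (by positivity), Real.mul_rpow (by positivity) (by positivity),
      ← Real.rpow_mul hQpos.le, ← Real.exp_mul]
    congr 2
    field_simp
  have h1 : kt ‖y‖ * Real.exp (-((p - 1) / 4 * ‖y‖ ^ 2 / (σ + s))) ≤ C₀ * (1 + C₁) * Q ^ (e / 2) := by
    have hexp1 : Real.exp (-((p - 1) / 4 * ‖y‖ ^ 2 / (σ + s))) ≤ 1 := by
      apply Real.exp_le_one_iff.2
      have : 0 ≤ (p - 1) / 4 * ‖y‖ ^ 2 / (σ + s) := by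
        have : 0 < p - 1 := by linarith
        positivity
      linarith
    have h2 := hb ‖y‖ (σ + s) (norm_nonneg y) hTpos
    have h3 : (σ + s) ^ (e / 2) ≤ Q ^ (e / 2) := by gcongr
    have h4 : 1 ≤ Q ^ (e / 2) := Real.one_le_rpow hQ1 (by positivity)
    calc kt ‖y‖ * Real.exp (-((p - 1) / 4 * ‖y‖ ^ 2 / (σ + s)))
        ≤ C₀ * (1 + ‖y‖ ^ e) * Real.exp (-((p - 1) / 4 * ‖y‖ ^ 2 / (σ + s))) := by
          gcongr; exact hk _ (norm_nonneg y)
      _ = C₀ * (Real.exp (-((p - 1) / 4 * ‖y‖ ^ 2 / (σ + s))) +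
            ‖y‖ ^ e * Real.exp (-((p - 1) / 4 * ‖y‖ ^ 2 / (σ + s)))) := by ring
      _ ≤ C₀ * (Q ^ (e / 2) + C₁ * Q ^ (e / 2)) := by
          have h5 : C₁ * (σ + s) ^ (e / 2) ≤ C₁ * Q ^ (e / 2) := by gcongr
          exact mul_le_mul_of_nonneg_left (by linarith) hC₀
      _ = _ := by ring
  rw [hV]
  have hQe : Q ^ (-((n : ℝ) * (p - 1) / 2 - e / 2)) = Q ^ (-(n : ℝ) / 2 * (p - 1)) * Q ^ (e / 2) := by
    rw [← Real.rpow_add hQpos]; congr 1; ring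
  rw [hQe]
  calc kt ‖y‖ * (M ^ (p - 1) * Q ^ (-(n : ℝ) / 2 * (p - 1)) *
        Real.exp (-((p - 1) / 4 * ‖y‖ ^ 2 / (σ + s))))
      = M ^ (p - 1) * Q ^ (-(n : ℝ) / 2 * (p - 1)) *
        (kt ‖y‖ * Real.exp (-((p - 1) / 4 * ‖y‖ ^ 2 / (σ + s)))) := by ring
    _ ≤ M ^ (p - 1) * Q ^ (-(n : ℝ) / 2 * (p - 1)) * (C₀ * (1 + C₁) * Q ^ (e / 2)) := by
        gcongr
    _ = _ := by ring

lemma duhamel_bound {n : ℕ} {M σ D N C K : ℝ} (hM : 0 < M) (hσ : 0 < σ) (hD : 0 ≤ D)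
    (hN : 1 < N) (hK : 0 ≤ K) {g : ℝ × EuclideanSpace ℝ (Fin n) → ℝ} (hc : Continuous g)
    (hb : ∀ s y, |g (s, y)| ≤ C * (1 + ‖y‖))
    (hg : ∀ s y, 0 ≤ s → |g (s, y)| ≤ K * (D * ((σ + s) / σ) ^ (-N)) * VV n M σ s y)
    {t : ℝ} (ht : 0 ≤ t) (x : EuclideanSpace ℝ (Fin n)) :
    |∫ s in (0:ℝ)..t, gH n (t - s) (fun y => g (s, y)) x| ≤
      K * (D * (σ / (N - 1))) * VV n M σ t x := by
  have hVc : ∀ s, 0 ≤ s → Continuous (VV n M σ s) := by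
    intro s hs
    have := (VV_cont n M hσ).comp (f := fun y => (s, y)) (by fun_prop)
    simpa [Function.comp_def, max_eq_left hs] using this
  have hVb : ∀ s, 0 ≤ s → ∀ a, ∀ y, |a * VV n M σ s y| ≤ |a| * M * (1 + ‖y‖) := by
    intro s hs a y
    rw [abs_mul, abs_of_pos (VV_pos hM hσ hs y), mul_assoc]
    refine mul_le_mul_of_nonneg_left ?_ (abs_nonneg a)
    have := VV_le hM hσ hs y
    nlinarith [norm_nonneg y]
  have hpt : ∀ s ∈ Ioc 0 t, ‖gH n (t - s) (fun y => g (s, y)) x‖ ≤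
      K * (D * ((σ + s) / σ) ^ (-N)) * VV n M σ t x := by
    rintro s ⟨hs0, hst⟩
    set A := K * (D * ((σ + s) / σ) ^ (-N)) with hA
    have e1 : ∀ A' : ℝ, gH n (t - s) (fun y => A' * VV n M σ s y) x = A' * VV n M σ t x := by
      intro A'
      rw [gH_const_mul, gH_VV' n hσ hs0.le (by linarith)]
      congr 2; ring
    rw [Real.norm_eq_abs, abs_le]
    constructor
    · rw [← neg_mul, ← e1 (-A)]
      refine gH_mono ((hVc s hs0.le).const_smul (-A)) (hVb s hs0.le _) (by fun_prop) (hb s) ?_ _ _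
      intro y
      change -A * VV n M σ s y ≤ g (s, y)
      rw [neg_mul]
      exact (abs_le.1 (hg s y hs0.le)).1
    · rw [← e1 A]
      refine gH_mono (by fun_prop) (hb s) ((hVc s hs0.le).const_smul A) (hVb s hs0.le _) ?_ _ _
      intro y
      exact (abs_le.1 (hg s y hs0.le)).2
  have hcont : ContinuousOn (fun s => K * (D * ((σ + s) / σ) ^ (-N)) * VV n M σ t x) (uIcc 0 t) := by
    rw [uIcc_of_le ht]
    intro s hs
    have hpos : 0 < (σ + s) / σ := by have := hs.1; positivity
    refine ContinuousAt.continuousWithinAt ?_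
    exact (continuousAt_const.mul (continuousAt_const.mul
      (ContinuousAt.rpow_const (f := fun s => (σ + s) / σ) (by fun_prop) (Or.inl hpos.ne')))).mul continuousAt_const
  have h1 := intervalIntegral.norm_integral_le_of_norm_le (μ := volume) ht
    (Filter.Eventually.of_forall hpt) hcont.intervalIntegrable
  rw [Real.norm_eq_abs] at h1
  refine h1.trans ?_
  rw [intervalIntegral.integral_mul_const, intervalIntegral.integral_const_mul,
    intervalIntegral.integral_const_mul]
  have h2 := time_integral hN hσ ht
  have h3 := (VV_pos (n := n) hM hσ ht x).le
  gcongr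

lemma exists_core (n : ℕ) (hn : 0 < n) {p C C₀ e M : ℝ} (hp : 1 < p) (he : 0 ≤ e) (hM : 0 < M)
    {kt : ℝ → ℝ} {f : ℝ → ℝ → ℝ} (hkc : Continuous kt) (hk0 : ∀ r, 0 ≤ kt r)
    (hkC : ∀ r, 0 ≤ r → kt r ≤ C * (1 + r))
    (hke : ∀ r, 0 ≤ r → kt r ≤ C₀ * (1 + r ^ e))
    (hf : ∀ u r, 0 < r → f u r = kt r * |u| ^ p)
    (hexp : 2 + e < (n : ℝ) * (p - 1)) :
    ∃ σ : ℝ, 0 < σ ∧ ∃ u : ℝ → EuclideanSpace ℝ (Fin n) → ℝ,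
      CBMildGlobal n f (VV n M σ 0) u ∧ ∀ t, 0 ≤ t → ∀ x, |u t x| ≤ 2 * VV n M σ t x := by
  have hC₀ : 0 ≤ C₀ := by
    have h1 := (hk0 0).trans (hke 0 le_rfl)
    have h2 : (0:ℝ) ≤ (0:ℝ) ^ e := Real.rpow_nonneg le_rfl _
    by_contra hneg
    push Not at hneg
    nlinarith
  obtain ⟨D, hD, hpot⟩ := potential_bound n hp he hM hke hC₀
  set N : ℝ := (n : ℝ) * (p - 1) / 2 - e / 2 with hNdef
  have hN : 1 < N := by rw [hNdef]; linarith
  set L : ℝ := 2 ^ p + p * 2 ^ (p - 1) with hL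
  have h2p : (0:ℝ) < 2 ^ p := by positivity
  have hL2 : 0 < p * (2:ℝ) ^ (p - 1) := by positivity
  have hLpos : 0 < L := by positivity
  set σ : ℝ := min 1 ((N - 1) / (2 * L * (D + 1))) with hσdef
  have hN1 : 0 < N - 1 := by linarith
  have hσ : 0 < σ := by
    rw [hσdef]; apply lt_min one_pos; positivity
  have hσ1 : σ ≤ 1 := min_le_left _ _
  have hsmall : L * (D * (σ / (N - 1))) ≤ 1 / 2 := by
    have h1 : σ ≤ (N - 1) / (2 * L * (D + 1)) := min_le_right _ _
    rw [le_div_iff₀ (by positivity)] at h1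
    have h2 : L * (D * (σ / (N - 1))) = (L * D * σ) / (N - 1) := by ring
    rw [h2, div_le_iff₀ hN1]
    have h3 : 0 ≤ L * σ := by positivity
    nlinarith
  set A : ℝ := D * (σ / (N - 1)) with hA
  have hA0 : 0 ≤ A := by positivity
  have hsm1 : 2 ^ p * A ≤ 1 := by nlinarith
  have hsm2 : p * 2 ^ (p - 1) * A ≤ 1 / 2 := by nlinarith
  refine ⟨σ, hσ, ?_⟩
  -- the weights
  set W : ℝ × EuclideanSpace ℝ (Fin n) → ℝ := fun q => VV n M σ (max q.1 0) q.2 with hW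
  have hWc : Continuous W := VV_cont n M hσ
  have hWpos : ∀ q, 0 < W q := fun q => VV_pos hM hσ (le_max_right _ _) _
  have hWle : ∀ q, W q ≤ M := fun q => VV_le hM hσ (le_max_right _ _) _
  -- the nonlinear term
  set G : (ℝ × EuclideanSpace ℝ (Fin n) → ℝ) → ℝ × EuclideanSpace ℝ (Fin n) → ℝ :=
    fun w q => kt ‖q.2‖ * W q ^ p * (min |w q| 2) ^ p with hG
  have hGc : ∀ w, Continuous w → Continuous (G w) := by
    intro w hw
    refine ((hkc.comp continuous_snd.norm).mul (hWc.rpow_const fun _ => Or.inr (by linarith))).mul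
      (Continuous.rpow_const (by fun_prop) fun _ => Or.inr (by linarith))
  have hmin0 : ∀ a : ℝ, 0 ≤ min |a| 2 := fun a => by positivity
  have hminp : ∀ a : ℝ, (min |a| 2) ^ p ≤ 2 ^ p := fun a =>
    Real.rpow_le_rpow (hmin0 a) (min_le_right _ _) (by linarith)
  have hminp0 : ∀ a : ℝ, 0 ≤ (min |a| 2) ^ p := fun a => Real.rpow_nonneg (hmin0 a) _
  have hG0 : ∀ w q, 0 ≤ G w q := fun w q =>
    mul_nonneg (mul_nonneg (hk0 _) (Real.rpow_nonneg (hWpos q).le _)) (hminp0 _)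
  have hGb : ∀ w s y, |G w (s, y)| ≤ (C * M ^ p * 2 ^ p) * (1 + ‖y‖) := by
    intro w s y
    rw [abs_of_nonneg (hG0 w _)]
    have h1 := hkC ‖y‖ (norm_nonneg y)
    have h2 : W (s, y) ^ p ≤ M ^ p := Real.rpow_le_rpow (hWpos _).le (hWle _) (by linarith)
    have h3 : 0 ≤ C * (1 + ‖y‖) := (hk0 _).trans h1
    calc kt ‖y‖ * W (s, y) ^ p * (min |w (s, y)| 2) ^ p
        ≤ (C * (1 + ‖y‖)) * M ^ p * 2 ^ p := by
          refine mul_le_mul (mul_le_mul h1 h2 (Real.rpow_nonneg (hWpos _).le _) h3) (hminp _)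
            (hminp0 _) (by positivity)
      _ = _ := by ring
  have hkW : ∀ s y, 0 ≤ s → kt ‖y‖ * W (s, y) ^ p ≤
      (D * ((σ + s) / σ) ^ (-N)) * VV n M σ s y := by
    intro s y hs
    have e0 : W (s, y) = VV n M σ s y := by simp [hW, max_eq_left hs]
    have hV := VV_pos (n := n) hM hσ hs y
    have e1 : VV n M σ s y ^ p = VV n M σ s y ^ (p - 1) * VV n M σ s y := by
      rw [← Real.rpow_add_one hV.ne']; congr 1; ring
    rw [e0, e1, ← mul_assoc]
    exact mul_le_mul_of_nonneg_right (hpot σ s hσ hσ1 hs y) hV.le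
  have hkW0 : ∀ s y, 0 ≤ kt ‖y‖ * W (s, y) ^ p := fun s y =>
    mul_nonneg (hk0 _) (Real.rpow_nonneg (hWpos _).le _)
  have hGK : ∀ w s y, 0 ≤ s → |G w (s, y)| ≤
      2 ^ p * (D * ((σ + s) / σ) ^ (-N)) * VV n M σ s y := by
    intro w s y hs
    rw [abs_of_nonneg (hG0 w _), mul_assoc, mul_comm ((2:ℝ) ^ p)]
    exact mul_le_mul (hkW s y hs) (hminp _) (hminp0 _) ((hkW0 s y).trans (hkW s y hs))
  -- Duhamel term
  set I : (ℝ × EuclideanSpace ℝ (Fin n) → ℝ) → ℝ × EuclideanSpace ℝ (Fin n) → ℝ :=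
    fun w q => ∫ s in (0:ℝ)..(max q.1 0), gH n (max q.1 0 - s) (fun y => G w (s, y)) q.2 with hI
  have hIc : ∀ w, Continuous w → Continuous (I w) := by
    intro w hw
    have h1 := continuous_gH (hGc w hw) (hGb w)
    refine intervalIntegral.continuous_parametric_intervalIntegral_of_continuous
      (f := fun (q : ℝ × EuclideanSpace ℝ (Fin n)) s =>
        gH n (max q.1 0 - s) (fun y => G w (s, y)) q.2) ?_ (by fun_prop)
    exact h1.comp (f := fun r : (ℝ × EuclideanSpace ℝ (Fin n)) × ℝ =>
      (max r.1.1 0 - r.2, r.2, r.1.2)) (by fun_prop)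
  have hIb : ∀ w, Continuous w → ∀ q, |I w q| ≤ 2 ^ p * A * W q := by
    intro w hw q
    exact duhamel_bound hM hσ hD hN h2p.le (hGc w hw) (hGb w) (hGK w) (le_max_right _ _) q.2
  have hΦb : ∀ w, Continuous w → ∀ q, |(W q)⁻¹ * I w q| ≤ 1 := by
    intro w hw q
    rw [abs_mul, abs_of_pos (inv_pos.2 (hWpos q)), inv_mul_le_iff₀ (hWpos q), mul_one]
    refine (hIb w hw q).trans ?_
    have := hWpos q
    nlinarith
  let Φ : BoundedContinuousFunction (ℝ × EuclideanSpace ℝ (Fin n)) ℝ →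
      BoundedContinuousFunction (ℝ × EuclideanSpace ℝ (Fin n)) ℝ := fun w =>
    BoundedContinuousFunction.ofNormedAddCommGroup (fun q => 1 + (W q)⁻¹ * I w q)
      (continuous_const.add ((hWc.inv₀ fun q => (hWpos q).ne').mul (hIc w w.continuous))) 2
      (fun q => by
        refine (norm_add_le _ _).trans ?_
        have := hΦb w w.continuous q
        rw [Real.norm_eq_abs, Real.norm_eq_abs, abs_one]
        linarith)
  have hΦ : ∀ w q, Φ w q = 1 + (W q)⁻¹ * I w q := fun w q => rfl
  have hIsub : ∀ w w' : BoundedContinuousFunction (ℝ × EuclideanSpace ℝ (Fin n)) ℝ, ∀ q,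
      |I w q - I w' q| ≤ (p * 2 ^ (p - 1) * dist w w') * A * W q := by
    intro w w' q
    have hcw : ∀ v : BoundedContinuousFunction (ℝ × EuclideanSpace ℝ (Fin n)) ℝ, Continuous
        fun s => gH n (max q.1 0 - s) (fun y => G v (s, y)) q.2 := by
      intro v
      exact (continuous_gH (hGc v v.continuous) (hGb v)).comp
        (f := fun s : ℝ => (max q.1 0 - s, s, q.2)) (by fun_prop)
    have e1 : I w q - I w' q = ∫ s in (0:ℝ)..(max q.1 0),
        gH n (max q.1 0 - s) (fun y => (fun r => G w r - G w' r) (s, y)) q.2 := by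
      simp only [hI]
      rw [← intervalIntegral.integral_sub ((hcw w).intervalIntegrable _ _)
        ((hcw w').intervalIntegrable _ _)]
      refine intervalIntegral.integral_congr fun s _ => ?_
      have c1 := hGc w w.continuous
      have c2 := hGc w' w'.continuous
      exact gH_sub (by fun_prop) (hGb w s) (by fun_prop) (hGb w' s) _ _
    rw [e1]
    refine duhamel_bound (C := 2 * (C * M ^ p * 2 ^ p)) hM hσ hD hN (by positivity)
      ((hGc w w.continuous).sub (hGc w' w'.continuous)) ?_ ?_ (le_max_right _ _) q.2
    · intro s y
      have h1 := hGb w s y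
      have h2 := hGb w' s y
      refine (abs_sub _ _).trans ?_
      linarith
    · intro s y hs
      have e2 : G w (s, y) - G w' (s, y) = (kt ‖y‖ * W (s, y) ^ p) *
          ((min |w (s, y)| 2) ^ p - (min |w' (s, y)| 2) ^ p) := by
        simp only [hG]; ring
      change |G w (s, y) - G w' (s, y)| ≤ _
      rw [e2, abs_mul, abs_of_nonneg (hkW0 s y)]
      have e3 : p * 2 ^ (p - 1) * dist w w' * (D * ((σ + s) / σ) ^ (-N)) * VV n M σ s y =
          ((D * ((σ + s) / σ) ^ (-N)) * VV n M σ s y) * (p * 2 ^ (p - 1) * dist w w') := by ring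
      rw [e3]
      refine mul_le_mul (hkW s y hs) ?_ (abs_nonneg _) ((hkW0 s y).trans (hkW s y hs))
      refine (trunc_lip hp _ _).trans (mul_le_mul_of_nonneg_left ?_ hL2.le)
      have := BoundedContinuousFunction.dist_coe_le_dist (f := w) (g := w') (s, y)
      rwa [Real.dist_eq] at this
  have hcontr : ContractingWith (1/2) Φ := by
    refine ⟨by norm_num, LipschitzWith.of_dist_le_mul fun w w' => ?_⟩
    have hd := dist_nonneg (x := w) (y := w')
    have hhalf : ((1/2 : NNReal) : ℝ) = 1/2 := by norm_num
    rw [hhalf]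
    rw [BoundedContinuousFunction.dist_le (by positivity)]
    intro q
    rw [hΦ, hΦ, Real.dist_eq, add_sub_add_left_eq_sub, ← mul_sub, abs_mul,
      abs_of_pos (inv_pos.2 (hWpos q)), inv_mul_le_iff₀ (hWpos q)]
    refine (hIsub w w' q).trans ?_
    have h1 : (p * 2 ^ (p - 1) * dist w w') * A * W q =
        (p * 2 ^ (p - 1) * A) * (dist w w' * W q) := by ring
    rw [h1]
    have h2 : 0 ≤ dist w w' * W q := mul_nonneg hd (hWpos q).le
    nlinarith
  set w := ContractingWith.fixedPoint Φ hcontr with hw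
  have hfix : Φ w = w := hcontr.fixedPoint_isFixedPt
  have hwq : ∀ q, w q = 1 + (W q)⁻¹ * I w q := fun q => by
    conv_lhs => rw [← hfix]
    exact hΦ w q
  have hw2 : ∀ q, |w q| ≤ 2 := by
    intro q
    rw [hwq q]
    refine (abs_add_le _ _).trans ?_
    have := hΦb w w.continuous q
    rw [abs_one]; linarith
  have hWt : ∀ t x, 0 ≤ t → W (t, x) = VV n M σ t x := by
    intro t x ht; simp [hW, max_eq_left ht]
  refine ⟨fun t x => W (t, x) * w (t, x), ⟨?_, ?_, ?_⟩, ?_⟩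
  · intro x
    change W (0, x) * w (0, x) = _
    rw [hwq]
    have : I w (0, x) = 0 := by simp [hI]
    rw [this, mul_zero, add_zero, mul_one, hWt 0 x le_rfl]
  · intro T hT
    refine ⟨Continuous.continuousOn ?_, M * 2, fun t _ x => ?_⟩
    · have h1 := w.continuous
      fun_prop
    · rw [abs_mul, abs_of_pos (hWpos _)]
      exact mul_le_mul (hWle _) (hw2 _) (abs_nonneg _) hM.le
  · intro t ht x
    have e1 : W (t, x) * w (t, x) = W (t, x) + I w (t, x) := by
      rw [hwq (t, x), mul_add, mul_one, mul_inv_cancel_left₀ (hWpos _).ne']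
    simp only
    rw [e1, heatOp_eq n ht, gH_VV n hσ le_rfl ht, zero_add, hWt t x ht.le]
    congr 1
    simp only [hI, max_eq_left ht.le]
    rw [intervalIntegral.integral_of_le ht.le, intervalIntegral.integral_of_le ht.le,
      integral_Ioc_eq_integral_Ioo, integral_Ioc_eq_integral_Ioo]
    refine setIntegral_congr_fun measurableSet_Ioo ?_
    rintro s ⟨hs0, hst⟩
    simp only
    rw [← heatOp_eq n (sub_pos.2 hst)]
    apply heatOp_congr hn
    intro y hy
    rw [hf _ _ (norm_pos_iff.2 hy)]
    simp only [hG]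
    rw [min_eq_left (hw2 _), abs_mul, abs_of_pos (hWpos _),
      Real.mul_rpow (hWpos _).le (abs_nonneg _), mul_assoc]
  · intro t ht x
    simp only
    rw [abs_mul, abs_of_pos (hWpos _), hWt t x ht, mul_comm]
    exact mul_le_mul_of_nonneg_right (hw2 _) (VV_pos hM hσ ht x).le

lemma VV_decay (n : ℕ) {M σ ν : ℝ} (hM : 0 < M) (hσ : 0 < σ) (hν : 0 ≤ ν) (hνn : ν < n) (ε' : ℝ)
    (hε : 0 < ε') : ∃ T : ℝ, 0 ≤ T ∧ ∀ t, T ≤ t → ∀ x : EuclideanSpace ℝ (Fin n),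
      2 * VV n M σ t x * (1 + ‖x‖ ^ ν) < ε' := by
  obtain ⟨C₁, hC₁, hb⟩ := rpow_exp_bound (e := ν) (b := 1 / 4) hν (by norm_num)
  have hlim : Tendsto (fun t : ℝ => 2 * M * σ ^ ((n:ℝ) / 2) *
      ((σ + t) ^ (-((n:ℝ) / 2)) + C₁ * (σ + t) ^ (-(((n:ℝ) - ν) / 2)))) atTop (nhds 0) := by
    have ht : Tendsto (fun t : ℝ => σ + t) atTop atTop := tendsto_atTop_add_const_left _ _ tendsto_id
    have h1 := (tendsto_rpow_neg_atTop (y := (n:ℝ) / 2) (by linarith)).comp ht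
    have h2 := (tendsto_rpow_neg_atTop (y := ((n:ℝ) - ν) / 2) (by linarith)).comp ht
    have h3 := (h1.add (h2.const_mul C₁)).const_mul (2 * M * σ ^ ((n:ℝ) / 2))
    simpa using h3
  obtain ⟨T, hT⟩ := Filter.eventually_atTop.1 (hlim.eventually_lt_const hε)
  refine ⟨max T 0, le_max_right _ _, fun t ht x => ?_⟩
  have ht0 : 0 ≤ t := (le_max_right _ _).trans ht
  have hpos : 0 < σ + t := by linarith
  refine lt_of_le_of_lt ?_ (hT t ((le_max_left _ _).trans ht))
  unfold VV
  have e1 : ((σ + t) / σ) ^ (-(n:ℝ) / 2) = σ ^ ((n:ℝ) / 2) * (σ + t) ^ (-((n:ℝ) / 2)) := by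
    have : -(n:ℝ) / 2 = -((n:ℝ) / 2) := by ring
    rw [this, Real.div_rpow hpos.le hσ.le, Real.rpow_neg hσ.le]
    field_simp
  have e2 : (σ + t) ^ (-(((n:ℝ) - ν) / 2)) = (σ + t) ^ (-((n:ℝ) / 2)) * (σ + t) ^ (ν / 2) := by
    rw [← Real.rpow_add hpos]; congr 1; ring
  have e3 : -‖x‖ ^ 2 / (4 * (σ + t)) = -(1 / 4 * ‖x‖ ^ 2 / (σ + t)) := by field_simp
  have h1 := hb ‖x‖ (σ + t) (norm_nonneg x) hpos
  have h2 : Real.exp (-(1 / 4 * ‖x‖ ^ 2 / (σ + t))) ≤ 1 := by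
    apply Real.exp_le_one_iff.2
    have : 0 ≤ 1 / 4 * ‖x‖ ^ 2 / (σ + t) := by positivity
    linarith
  rw [e1, e2, e3]
  calc 2 * (M * (σ ^ ((n:ℝ) / 2) * (σ + t) ^ (-((n:ℝ) / 2))) *
        Real.exp (-(1 / 4 * ‖x‖ ^ 2 / (σ + t)))) * (1 + ‖x‖ ^ ν)
      = 2 * M * σ ^ ((n:ℝ) / 2) * (σ + t) ^ (-((n:ℝ) / 2)) *
        (Real.exp (-(1 / 4 * ‖x‖ ^ 2 / (σ + t))) +
          ‖x‖ ^ ν * Real.exp (-(1 / 4 * ‖x‖ ^ 2 / (σ + t)))) := by ring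
    _ ≤ 2 * M * σ ^ ((n:ℝ) / 2) * (σ + t) ^ (-((n:ℝ) / 2)) * (1 + C₁ * (σ + t) ^ (ν / 2)) := by
        gcongr
    _ = _ := by ring

lemma low_lt_star (n : ℕ) (hn : (2:ℝ) < n) : twoLow n < twoStar n := by
  unfold twoLow twoStar
  have : (0:ℝ) < n - 2 := by linarith
  gcongr
  linarith

lemma exponent_ineq (n : ℕ) (hn : (2:ℝ) < n) {l q d : ℝ} (hd : -2 < d)
    (hl : l = 2 * (q + d) / (2 + d)) (h : twoLow n < l) : 2 + d < (q - 2) * ((n:ℝ) - 2) := by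
  have h1 : (0:ℝ) < n - 2 := by linarith
  have h2 : 0 < 2 + d := by linarith
  rw [hl, twoLow, div_lt_div_iff₀ h1 h2] at h
  nlinarith

lemma extend_k (k : ℝ → ℝ)
    (hklip : ∃ L : ℝ, ∀ r s : ℝ, 0 < r → 0 < s → |k r - k s| ≤ L * |r - s|)
    (hkpos : ∀ r : ℝ, 0 < r → 0 < k r) :
    ∃ (kt : ℝ → ℝ) (C : ℝ), Continuous kt ∧ (∀ r, 0 ≤ kt r) ∧ (∀ r, 0 < r → kt r = k r) ∧
      ∀ r, 0 ≤ r → kt r ≤ C * (1 + r) := by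
  obtain ⟨L, hL⟩ := hklip
  have h1 : LipschitzOnWith (Real.toNNReal L) k (Ioi 0) := by
    refine LipschitzOnWith.of_dist_le_mul fun r hr s hs => ?_
    rw [Real.dist_eq, Real.dist_eq]
    refine (hL r s hr hs).trans ?_
    gcongr
    exact Real.le_coe_toNNReal L
  obtain ⟨g, hg, hgk⟩ := h1.extend_real
  refine ⟨fun r => max (g r) 0, |g 0| + (Real.toNNReal L : ℝ), hg.continuous.max continuous_const,
    fun r => le_max_right _ _, fun r hr => ?_, fun r hr => ?_⟩
  · change max (g r) 0 = k r
    rw [← hgk hr, max_eq_left (hkpos r hr).le]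
  · have h2 := hg.dist_le_mul r 0
    rw [Real.dist_eq, Real.dist_eq, sub_zero, abs_of_nonneg hr] at h2
    have h3 := le_abs_self (g r - g 0)
    have h4 := le_abs_self (g 0)
    have h5 : (0:ℝ) ≤ (Real.toNNReal L : ℝ) := NNReal.coe_nonneg _
    apply max_le
    · nlinarith [abs_nonneg (g 0)]
    · positivity

lemma delta_nonneg (k kt : ℝ → ℝ) (C δ A : ℝ) (hA : 0 < A) (hk : ∀ r, 0 < r → kt r = k r)
    (hC : ∀ r, 0 ≤ r → kt r ≤ C * (1 + r))
    (hk0 : Tendsto (fun r => k r * r ^ (-δ)) (nhdsWithin 0 (Set.Ioi 0)) (nhds A)) : 0 ≤ δ := by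
  by_contra hneg
  push Not at hneg
  have h1 : Tendsto (fun r : ℝ => C * (1 + r) * r ^ (-δ)) (nhdsWithin 0 (Ioi 0)) (nhds 0) := by
    have h2 : ContinuousAt (fun r : ℝ => C * (1 + r) * r ^ (-δ)) 0 := by
      refine ContinuousAt.mul (by fun_prop) ?_
      exact Real.continuousAt_rpow_const _ _ (Or.inr (by linarith))
    have h3 := h2.tendsto
    rw [Real.zero_rpow (by linarith), mul_zero] at h3
    exact h3.mono_left nhdsWithin_le_nhds
  have h4 : A ≤ 0 := by
    refine le_of_tendsto_of_tendsto hk0 h1 ?_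
    filter_upwards [self_mem_nhdsWithin] with r hr
    have hr' : 0 < r := hr
    rw [← hk r hr']
    exact mul_le_mul_of_nonneg_right (hC r hr'.le) (by positivity)
  linarith

lemma k_upper (k kt : ℝ → ℝ) (C η B : ℝ) (hk0 : ∀ r, 0 ≤ kt r) (hk : ∀ r, 0 < r → kt r = k r)
    (hC : ∀ r, 0 ≤ r → kt r ≤ C * (1 + r))
    (hkinf : Tendsto (fun r => k r * r ^ (-η)) atTop (nhds B)) :
    ∃ C₀ : ℝ, ∀ r, 0 ≤ r → kt r ≤ C₀ * (1 + r ^ (max η 0)) := by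
  obtain ⟨R, hR⟩ := Filter.eventually_atTop.1
    (hkinf.eventually_lt_const (lt_add_of_le_of_pos (le_abs_self B) one_pos))
  set R₁ := max R 1 with hR₁
  have hR1 : 1 ≤ R₁ := le_max_right _ _
  have hCnn : 0 ≤ C := by
    have := (hk0 0).trans (hC 0 le_rfl)
    simpa using this
  refine ⟨C * (1 + R₁) + (|B| + 1), fun r hr => ?_⟩
  have hre : 0 ≤ r ^ (max η 0) := Real.rpow_nonneg hr _
  have h1 : 0 ≤ C * (1 + R₁) := by positivity
  have h2 := abs_nonneg B
  rcases le_total r R₁ with h | h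
  · have h3 : C * (1 + r) ≤ C * (1 + R₁) := by gcongr
    have h4 := hC r hr
    nlinarith
  · have hr1 : 1 ≤ r := hR1.trans h
    have hrpos : 0 < r := by linarith
    have h3 := hR r ((le_max_left _ _).trans h)
    rw [Real.rpow_neg hr, ← div_eq_mul_inv, div_lt_iff₀ (by positivity)] at h3
    have h4 : r ^ η ≤ r ^ (max η 0) := Real.rpow_le_rpow_of_exponent_le hr1 (le_max_left _ _)
    rw [hk r hrpos]
    nlinarith

lemma choose_R (k : ℝ → ℝ) (η B a c p : ℝ) (hη : -2 < η) (hB : 0 < B) (ha : 0 < a) (hc : 0 < c)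
    (hp : 1 < p) (hkinf : Tendsto (fun r => k r * r ^ (-η)) atTop (nhds B)) :
    ∃ R : ℝ, 0 < R ∧ (∀ r, R ≤ r → r ≤ 3 * R → B / 18 * R ^ η ≤ k r) ∧
      2 ≤ a * (B / 18 * R ^ η) * c ^ (p - 1) * R ^ 2 * (1 - 2 ^ (1 - p)) := by
  obtain ⟨R₀, hR₀⟩ := Filter.eventually_atTop.1
    (hkinf.eventually_const_lt (show B / 2 < B by linarith))
  have h2 : (0:ℝ) < 1 - 2 ^ (1 - p) := by
    have : (2:ℝ) ^ (1 - p) < 1 :=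
      Real.rpow_lt_one_of_one_lt_of_neg (by norm_num) (by linarith)
    linarith
  have hK : 0 < a * (B / 18) * c ^ (p - 1) * (1 - 2 ^ (1 - p)) := by positivity
  have hlim := (tendsto_rpow_atTop (y := 2 + η) (by linarith)).const_mul_atTop hK
  obtain ⟨R, hR1, hR2, hR3⟩ := ((hlim.eventually_ge_atTop 2).and
    ((eventually_ge_atTop R₀).and (eventually_ge_atTop 1))).exists
  have hRpos : 0 < R := by linarith
  refine ⟨R, hRpos, fun r h1 h3 => ?_, ?_⟩
  · have hr : 0 < r := by linarith
    have h4 := hR₀ r (hR2.trans h1)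
    rw [Real.rpow_neg hr.le, ← div_eq_mul_inv, lt_div_iff₀ (by positivity)] at h4
    have e1 : r ^ η = (r / R) ^ η * R ^ η := by
      rw [← Real.mul_rpow (by positivity) hRpos.le, div_mul_cancel₀ _ hRpos.ne']
    have hθ1 : 1 ≤ r / R := by rw [le_div_iff₀ hRpos]; linarith
    have hθ3 : r / R ≤ 3 := by rw [div_le_iff₀ hRpos]; linarith
    have h5 : (r / R) ^ (-2 : ℝ) ≤ (r / R) ^ η := Real.rpow_le_rpow_of_exponent_le hθ1 hη.le
    have h6 : (1:ℝ) / 9 ≤ (r / R) ^ (-2 : ℝ) := by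
      rw [Real.rpow_neg (by positivity), Real.rpow_ofNat, one_div]
      apply inv_anti₀ (by positivity)
      nlinarith
    have hRη : 0 < R ^ η := by positivity
    have h7 : 1 / 9 * R ^ η ≤ r ^ η := by
      rw [e1]; gcongr; exact h6.trans h5
    nlinarith
  · have e2 : R ^ (2 + η) = R ^ 2 * R ^ η := by
      rw [Real.rpow_add hRpos, Real.rpow_ofNat]
    rw [e2] at hR1
    calc (2:ℝ) ≤ _ := hR1
      _ = _ := by ring

end Aux

/-- arbitrarily small smooth initial data which blow up in finite time, and
arbitrarily large smooth initial data whose solutions fade to zero with weighted decay. -/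
theorem small_data_blowup_large_data_decay
    (n : ℕ) (hn : 2 < n)
    (q δ η A B : ℝ) (k k' : ℝ → ℝ)
    (hq : 2 < q) (hδ : -2 < δ) (hη : -2 < η) (hA : 0 < A) (hB : 0 < B)
    (hkpos : ∀ r : ℝ, 0 < r → 0 < k r)
    (hkd : ∀ r : ℝ, 0 < r → HasDerivAt k (k' r) r)
    (hkdc : ContinuousOn k' (Set.Ioi 0))
    (hklip : ∃ L : ℝ, ∀ r s : ℝ, 0 < r → 0 < s → |k r - k s| ≤ L * |r - s|)
    (hk0 : Tendsto (fun r => k r * r ^ (-δ)) (nhdsWithin 0 (Set.Ioi 0)) (nhds A))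
    (hkinf : Tendsto (fun r => k r * r ^ (-η)) atTop (nhds B))
    (lu ls : ℝ) (hlu : lu = 2 * (q + δ) / (2 + δ)) (hls : ls = 2 * (q + η) / (2 + η))
    (hcase :
      (((∀ r : ℝ, 0 < r →
          0 ≤ (∫ s in (0:ℝ)..r, s ^ (((n : ℝ) - 2) * q / 2) *
            deriv (fun t => k t * t ^ (((n : ℝ) - 2) * (Paper.twoStar n - q) / 2)) s)) ∧
        (∃ r : ℝ, 0 < r ∧
          0 < (∫ s in (0:ℝ)..r, s ^ (((n : ℝ) - 2) * q / 2) *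
            deriv (fun t => k t * t ^ (((n : ℝ) - 2) * (Paper.twoStar n - q) / 2)) s))) ∧
        Paper.twoLow n < lu ∧ lu ≤ Paper.twoStar n ∧
        Paper.twoLow n < ls ∧ ls ≤ Paper.twoStar n) ∨
      (((∀ r : ℝ, 0 < r →
          (∫ s in (0:ℝ)..r, s ^ (((n : ℝ) - 2) * q / 2) *
            deriv (fun t => k t * t ^ (((n : ℝ) - 2) * (Paper.twoStar n - q) / 2)) s) ≤ 0) ∧
        (∃ r : ℝ, 0 < r ∧
          (∫ s in (0:ℝ)..r, s ^ (((n : ℝ) - 2) * q / 2) *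
            deriv (fun t => k t * t ^ (((n : ℝ) - 2) * (Paper.twoStar n - q) / 2)) s) < 0)) ∧
        Paper.twoStar n ≤ lu ∧ Paper.twoStar n ≤ ls))
    (f : ℝ → ℝ → ℝ) (hfdef : ∀ u r : ℝ, f u r = k r * |u| ^ (q - 1)) :
    ∀ ε : ℝ, 0 < ε →
      (∃ φ : EuclideanSpace ℝ (Fin n) → ℝ, ContDiff ℝ (⊤ : ℕ∞) φ ∧ (∀ x, 0 ≤ φ x) ∧
        (∃ c : ℝ, c < ε ∧ ∀ x, |φ x| ≤ c) ∧
        ¬ ∃ u : ℝ → EuclideanSpace ℝ (Fin n) → ℝ, Paper.CBMildGlobal n f φ u) ∧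
      (∃ φ : EuclideanSpace ℝ (Fin n) → ℝ, ContDiff ℝ (⊤ : ℕ∞) φ ∧ (∀ x, 0 ≤ φ x) ∧
        (∃ x, 1 / ε < |φ x|) ∧
        ∃ u : ℝ → EuclideanSpace ℝ (Fin n) → ℝ,
          Paper.CBMildGlobal n f φ u ∧
          (∀ ν : ℝ, 0 ≤ ν → ν < (n : ℝ) - 2 →
            ∀ ε' : ℝ, 0 < ε' → ∃ T : ℝ, ∀ t : ℝ, T ≤ t → ∀ x,
              |u t x| * (1 + ‖x‖ ^ ν) < ε')) := by
  have hn0 : 0 < n := by omega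
  have hnR : (2:ℝ) < n := by exact_mod_cast hn
  obtain ⟨hexpu, hexps⟩ : 2 + δ < (q - 2) * ((n:ℝ) - 2) ∧ 2 + η < (q - 2) * ((n:ℝ) - 2) := by
    rcases hcase with ⟨_, h1, _, h2, _⟩ | ⟨_, h1, h2⟩
    · exact ⟨Aux.exponent_ineq n hnR hδ hlu h1, Aux.exponent_ineq n hnR hη hls h2⟩
    · exact ⟨Aux.exponent_ineq n hnR hδ hlu ((Aux.low_lt_star n hnR).trans_le h1),
        Aux.exponent_ineq n hnR hη hls ((Aux.low_lt_star n hnR).trans_le h2)⟩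
  clear hcase hlu hls hkd hkdc
  obtain ⟨kt, C, hktc, hkt0, hktk, hktC⟩ := Aux.extend_k k hklip hkpos
  have hδ0 : 0 ≤ δ := Aux.delta_nonneg k kt C δ A hA hktk hktC hk0
  obtain ⟨C₀, hke⟩ := Aux.k_upper k kt C η B hkt0 hktk hktC hkinf
  have hf : ∀ u r : ℝ, 0 < r → f u r = kt r * |u| ^ (q - 1) := by
    intro u r hr
    rw [hfdef, hktk r hr]
  intro ε hε
  constructor
  · refine ⟨fun _ => ε / 2, contDiff_const, fun _ => by positivity,
      ⟨ε / 2, by linarith, fun _ => by rw [abs_of_pos (by positivity)]⟩, ?_⟩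
    obtain ⟨a, ha, hblow⟩ := Aux.blowup_core n hn0
    obtain ⟨R, hR, hRk, hRbig⟩ := Aux.choose_R k η B a (ε / 2) (q - 1) hη hB ha (by positivity)
      (by linarith) hkinf
    have : Nonempty (Fin n) := ⟨⟨0, hn0⟩⟩
    obtain ⟨x₀, hx₀⟩ := exists_norm_eq (EuclideanSpace ℝ (Fin n)) (c := 2 * R) (by positivity)
    refine hblow (q - 1) C kt f (by linarith) hktc hkt0 hktC hf x₀ R (B / 18 * R ^ η) (ε / 2) hR
      (by positivity) (by positivity) ?_ hRbig
    intro y hy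
    rw [mem_closedBall_iff_norm] at hy
    have h1 : R ≤ ‖y‖ := by
      have := norm_sub_norm_le x₀ y
      rw [norm_sub_rev] at this
      linarith
    have h2 : ‖y‖ ≤ 3 * R := by
      have := norm_sub_norm_le y x₀
      linarith
    rw [hktk _ (by linarith)]
    exact hRk _ h1 h2
  · have hexp : 2 + max η 0 < (n:ℝ) * ((q - 1) - 1) := by
      have h3 : (q - 2) * ((n:ℝ) - 2) < (n:ℝ) * ((q - 1) - 1) := by nlinarith
      rcases max_cases η 0 with ⟨h, _⟩ | ⟨h, _⟩ <;> rw [h] <;> linarith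
    obtain ⟨σ, hσ, u, hu, hub⟩ := Aux.exists_core n hn0 (p := q - 1) (M := 1 / ε + 1) (by linarith)
      (le_max_right η 0) (by positivity) hktc hkt0 hktC hke hf hexp
    have hM : 0 < 1 / ε + 1 := by positivity
    refine ⟨_, ?_, fun x => (Aux.VV_pos hM hσ le_rfl x).le, ⟨0, ?_⟩, u, hu, ?_⟩
    · unfold Aux.VV
      refine contDiff_const.mul (Real.contDiff_exp.comp ?_)
      exact ((contDiff_norm_sq ℝ).neg).div_const _
    · rw [abs_of_pos (Aux.VV_pos hM hσ le_rfl _)]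
      simp [Aux.VV, hσ.ne']
    · intro ν hν hνn ε' hε'
      obtain ⟨T, hT0, hT⟩ := Aux.VV_decay n hM hσ hν (by linarith) ε' hε'
      refine ⟨T, fun t ht x => lt_of_le_of_lt ?_ (hT t ht x)⟩
      exact mul_le_mul_of_nonneg_right (hub t (hT0.trans ht) x) (by positivity)
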